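/- Let N ≥ 2 and let U_1, …, U_n (n ≥ 1) be unitaries on ℂ^N ⊗ ℂ^N. Then the average of e_p(U_n·W_{n−1}·U_{n−1} ⋯ W_1·U_1) over the local gates W_j = U^A_j ⊗ U^B_j, with all U^A_j, U^B_j drawn independently from the Haar probability measure on U(N), equals ē_p·[1 − ∏_{k=1}^n (1 − e_p(U_k)/ē_p)], where ē_p = (N−1)²/(N²+1). -/

import Mathlib

open Matrix MeasureTheory
open scoped Kronecker

noncomputable section

instance {m n R : Type*} [TopologicalSpace R] : MeasurableSpace (Matrix m n R) := borel _
instance {m n R : Type*} [TopologicalSpace R] : BorelSpace (Matrix m n R) := ⟨rfl⟩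

/-- Reshuffling: `(U_R)_{(i,j),(α,β)} = U_{(i,α),(j,β)}`. -/
def reshuffle (N : ℕ) (U : Matrix (Fin N × Fin N) (Fin N × Fin N) ℂ) :
    Matrix (Fin N × Fin N) (Fin N × Fin N) ℂ :=
  Matrix.of fun p q => U (p.1, q.1) (p.2, q.2)

/-- Partial transpose: `(U_Γ)_{(j,α),(i,β)} = U_{(i,α),(j,β)}`. -/
def ptransp (N : ℕ) (U : Matrix (Fin N × Fin N) (Fin N × Fin N) ℂ) :
    Matrix (Fin N × Fin N) (Fin N × Fin N) ℂ :=
  Matrix.of fun p q => U (q.1, p.2) (p.1, q.2)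

/-- The swap gate `S(x ⊗ y) = y ⊗ x`. -/
def swapGate (N : ℕ) : Matrix (Fin N × Fin N) (Fin N × Fin N) ℂ :=
  Matrix.of fun p q => if p.1 = q.2 ∧ p.2 = q.1 then 1 else 0

/-- `ρ_R(U) = U_R U_R† / N²`. -/
def rhoR (N : ℕ) (U : Matrix (Fin N × Fin N) (Fin N × Fin N) ℂ) :
    Matrix (Fin N × Fin N) (Fin N × Fin N) ℂ :=
  ((N : ℂ) ^ 2)⁻¹ • (reshuffle N U * (reshuffle N U)ᴴ)

/-- `ρ_T(U) = S U_Γ U_Γ† S / N²`. -/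
def rhoT (N : ℕ) (U : Matrix (Fin N × Fin N) (Fin N × Fin N) ℂ) :
    Matrix (Fin N × Fin N) (Fin N × Fin N) ℂ :=
  ((N : ℂ) ^ 2)⁻¹ • (swapGate N * (ptransp N U * (ptransp N U)ᴴ) * swapGate N)

/-- Purity `X(U) = tr(ρ_R(U)²)` (a real number). -/
def Xpur (N : ℕ) (U : Matrix (Fin N × Fin N) (Fin N × Fin N) ℂ) : ℝ :=
  ((rhoR N U * rhoR N U).trace).re

/-- Purity `Y(U) = tr(ρ_T(U)²)` (a real number). -/
def Ypur (N : ℕ) (U : Matrix (Fin N × Fin N) (Fin N × Fin N) ℂ) : ℝ :=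
  ((rhoT N U * rhoT N U).trace).re

/-- Entangling power `e_p(U)`. -/
def ep (N : ℕ) (U : Matrix (Fin N × Fin N) (Fin N × Fin N) ℂ) : ℝ :=
  ((N : ℝ) ^ 2 / ((N : ℝ) + 1) ^ 2) *
    ((1 - Xpur N U) + (1 - Ypur N U) - ((N : ℝ) ^ 2 - 1) / (N : ℝ) ^ 2)

/-- Gate typicality `g_t(U)`. -/
def gateTyp (N : ℕ) (U : Matrix (Fin N × Fin N) (Fin N × Fin N) ℂ) : ℝ :=
  ((N : ℝ) ^ 2 / ((N : ℝ) ^ 2 - 1)) *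
    (Ypur N U - Xpur N U + ((N : ℝ) ^ 2 - 1) / (N : ℝ) ^ 2)

/-- Mean entangling power over the Haar measure, `ē_p = (N-1)²/(N²+1)`. -/
def epBar (N : ℕ) : ℝ := ((N : ℝ) - 1) ^ 2 / ((N : ℝ) ^ 2 + 1)

/-- `iterGate U W k = U · W_{k-1} · U ⋯ W_0 · U`, i.e. `U^(k+1)` with `k` interlacing
local gates `W_0, …, W_{k-1}`. -/
def iterGate {D : Type*} [Fintype D] [DecidableEq D] (U : Matrix D D ℂ)
    (W : ℕ → Matrix D D ℂ) : ℕ → Matrix D D ℂ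
  | 0 => U
  | k + 1 => U * W k * iterGate U W k

/-- `chainGate Us W k = Us_k · W_{k-1} · Us_{k-1} ⋯ W_0 · Us_0`. -/
def chainGate {D : Type*} [Fintype D] [DecidableEq D] (Us W : ℕ → Matrix D D ℂ) :
    ℕ → Matrix D D ℂ
  | 0 => Us 0
  | k + 1 => Us (k + 1) * W k * chainGate Us W k

/-- The operator `X ⊗ 1 + 1 ⊗ X` on two copies of the space `X` acts on. -/
def symSum {ι : Type*} [DecidableEq ι] (X : Matrix ι ι ℂ) : Matrix (ι × ι) (ι × ι) ℂ :=
  X ⊗ₖ 1 + 1 ⊗ₖ X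

section Commutant

theorem mul_single_apply {l m n : Type*} [Fintype m] [DecidableEq m] [DecidableEq n]
    (M : Matrix l m ℂ) (i : m) (j : n) (c : ℂ) (a : l) (b : n) :
    (M * single i j c) a b = if b = j then M a i * c else 0 := by
  split_ifs with h
  · rw [h, mul_single_apply_same]
  · rw [mul_single_apply_of_ne _ _ _ _ _ h]

theorem single_mul_apply {l m n : Type*} [Fintype m] [DecidableEq m] [DecidableEq l]
    (M : Matrix m n ℂ) (i : l) (j : m) (c : ℂ) (a : l) (b : n) :
    (single i j c * M) a b = if a = i then c * M j b else 0 := by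
  split_ifs with h
  · rw [h, single_mul_apply_same]
  · rw [single_mul_apply_of_ne _ _ _ _ _ h]

variable {ι : Type*} [DecidableEq ι]

theorem symSum_add (X Y : Matrix ι ι ℂ) : symSum (X + Y) = symSum X + symSum Y := by
  simp only [symSum, add_kronecker, kronecker_add]
  abel

theorem symSum_smul (c : ℂ) (X : Matrix ι ι ℂ) : symSum (c • X) = c • symSum X := by
  simp only [symSum, smul_kronecker, kronecker_smul, smul_add]

theorem one_add_smul_kronecker_self (P : Matrix ι ι ℂ) (c : ℂ) :
    (1 + c • P) ⊗ₖ (1 + c • P) = 1 + (c • symSum P + c ^ 2 • (P ⊗ₖ P)) := by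
  simp only [symSum, add_kronecker, kronecker_add, smul_kronecker, kronecker_smul,
    one_kronecker_one, smul_add, smul_smul, ← sq]
  abel

variable [Fintype ι]

theorem symSum_mul (X Y : Matrix ι ι ℂ) :
    symSum X * symSum Y = symSum (X * Y) + (X ⊗ₖ Y + Y ⊗ₖ X) := by
  simp only [symSum, mul_add, add_mul, ← mul_kronecker_mul, mul_one, one_mul]
  abel

theorem one_add_smul_mem_unitaryGroup {P : Matrix ι ι ℂ} (hP : Pᴴ = P) (hPP : P * P = P) {c : ℂ}
    (hc : c + star c + c * star c = 0) : 1 + c • P ∈ unitaryGroup ι ℂ := by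
  rw [mem_unitaryGroup_iff, star_eq_conjTranspose, conjTranspose_add, conjTranspose_one,
    conjTranspose_smul, hP]
  simp only [mul_add, add_mul, one_mul, mul_one, smul_mul_smul_comm, hPP]
  rw [add_assoc, ← add_smul, ← add_smul, ← add_assoc, hc]
  simp

theorem commute_symSum_of_projection {K : Matrix (ι × ι) (ι × ι) ℂ}
    (hK : ∀ G ∈ unitaryGroup ι ℂ, Commute K (G ⊗ₖ G))
    {P : Matrix ι ι ℂ} (hP : Pᴴ = P) (hPP : P * P = P) : Commute K (symSum P) := by
  have key : ∀ c : ℂ, c + star c + c * star c = 0 →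
      Commute K (c • symSum P + c ^ 2 • (P ⊗ₖ P)) := by
    intro c hc
    have h := hK _ (one_add_smul_mem_unitaryGroup hP hPP hc)
    rw [one_add_smul_kronecker_self] at h
    simpa using h.sub_right (Commute.one_right K)
  have h1 := key (-2) (by norm_num)
  have h2 := key (Complex.I - 1) (by
    simp only [star_sub, star_one, RCLike.star_def, Complex.conj_I]
    ring_nf
    simp)
  have e : symSum P = (-Complex.I / 2) • ((-2 : ℂ) • symSum P + (-2 : ℂ) ^ 2 • (P ⊗ₖ P)) +
      (-1 : ℂ) • ((Complex.I - 1) • symSum P + (Complex.I - 1) ^ 2 • (P ⊗ₖ P)) := by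
    match_scalars
    · ring
    · linear_combination Complex.I_sq
  rw [e]
  exact (h1.smul_right _).add_right (h2.smul_right _)

theorem commute_symSum_single_add_single {K : Matrix (ι × ι) (ι × ι) ℂ}
    (hK : ∀ G ∈ unitaryGroup ι ℂ, Commute K (G ⊗ₖ G)) {i j : ι} (hij : i ≠ j)
    {ω : ℂ} (hω : ω * star ω = 1) :
    Commute K (symSum ((2⁻¹ : ℂ) • (single i i (1 : ℂ) + single j j (1 : ℂ) +
      ω • single i j (1 : ℂ) + star ω • single j i (1 : ℂ)))) := by
  apply commute_symSum_of_projection hK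
  · simp only [conjTranspose_smul, conjTranspose_add, conjTranspose_single, star_star,
      star_one, star_inv₀, star_ofNat]
    abel_nf
  · simp only [smul_mul_assoc, mul_smul_comm, mul_add, add_mul, single_mul_single_same,
      mul_one, single_mul_single_of_ne _ _ _ _ hij, single_mul_single_of_ne _ _ _ _ hij.symm,
      smul_zero, add_zero, zero_add]
    match_scalars
    · linear_combination (1 / 4 : ℂ) * hω
    · ring
    · linear_combination (1 / 4 : ℂ) * hω
    · ring

theorem commute_symSum_single {K : Matrix (ι × ι) (ι × ι) ℂ}
    (hK : ∀ G ∈ unitaryGroup ι ℂ, Commute K (G ⊗ₖ G)) (i j : ι) :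
    Commute K (symSum (single i j 1)) := by
  have diag (i : ι) : Commute K (symSum (single i i 1)) :=
    commute_symSum_of_projection hK (by simp) (by simp)
  obtain rfl | hij := eq_or_ne i j
  · exact diag i
  have h1 := commute_symSum_single_add_single hK hij (ω := 1) (by simp)
  have h2 := commute_symSum_single_add_single hK hij (ω := Complex.I) (by simp)
  have h3 := (diag i).add_right (diag j)
  have h := (h1.add_right (h2.smul_right (-Complex.I))).add_right
    (h3.smul_right ((-1 + Complex.I) / 2))
  rw [← symSum_add, ← symSum_smul, ← symSum_smul, ← symSum_add, ← symSum_add] at h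
  refine Eq.mpr (congrArg (fun X => Commute K (symSum X)) ?_) h
  simp only [RCLike.star_def, Complex.conj_I, map_one]
  match_scalars
  · linear_combination (1 / 2 : ℂ) * Complex.I_sq
  · ring
  · ring
  · linear_combination (-1 / 2 : ℂ) * Complex.I_sq

theorem commute_single_kronecker_symm {K : Matrix (ι × ι) (ι × ι) ℂ}
    (hK : ∀ G ∈ unitaryGroup ι ℂ, Commute K (G ⊗ₖ G)) (i j k l : ι) :
    Commute K (single i j 1 ⊗ₖ single k l 1 + single k l 1 ⊗ₖ single i j 1) := by
  have hs := commute_symSum_single hK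
  have hmul : Commute K (symSum (single i j 1 * single k l 1)) := by
    obtain rfl | h := eq_or_ne j k
    · simpa using hs i l
    · simp [single_mul_single_of_ne _ _ _ _ h, symSum]
  have h := ((hs i j).mul_right (hs k l)).sub_right hmul
  rwa [symSum_mul, add_sub_cancel_left] at h

/-- An operator on two copies commuting with every `G ⊗ G`, `G` unitary, is a combination of the
identity and the exchange of the two copies, with coefficients determined by two traces. -/
theorem entry_of_commute_kronecker_self {K : Matrix (ι × ι) (ι × ι) ℂ}
    (hK : ∀ G ∈ unitaryGroup ι ℂ, Commute K (G ⊗ₖ G)) (p q i k : ι) :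
    ((Fintype.card ι : ℂ) ^ 4 - (Fintype.card ι : ℂ) ^ 2) * K (p, q) (i, k) =
      (if p = i ∧ q = k then 1 else 0) * ((Fintype.card ι : ℂ) ^ 2 * (∑ x, ∑ y, K (x, y) (x, y)) -
        Fintype.card ι * ∑ x, ∑ y, K (x, y) (y, x)) +
      (if p = k ∧ q = i then 1 else 0) * ((Fintype.card ι : ℂ) ^ 2 * (∑ x, ∑ y, K (x, y) (y, x)) -
        Fintype.card ι * ∑ x, ∑ y, K (x, y) (x, y)) := by
  have key (i k : ι) : (Fintype.card ι : ℂ) ^ 2 * K (p, q) (i, k) +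
      Fintype.card ι * K (p, q) (k, i) =
      (if p = i ∧ q = k then 1 else 0) * (∑ x, ∑ y, K (x, y) (x, y)) +
      (if p = k ∧ q = i then 1 else 0) * ∑ x, ∑ y, K (x, y) (y, x) := by
    have h (j l : ι) : K (p, q) (i, k) + (if j = l then K (p, q) (k, i) else 0) =
        (if p = i ∧ q = k then 1 else 0) * K (j, l) (j, l) +
        (if p = k ∧ q = i then 1 else 0) * K (l, j) (j, l) := by
      have h := congrFun (congrFun (commute_single_kronecker_symm hK i j k l).eq (p, q)) (j, l)
      simp only [single_kronecker_single, mul_add, add_mul, mul_one, Matrix.add_apply,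
        mul_single_apply, single_mul_apply, Prod.mk.injEq, if_true] at h
      simpa [eq_comm] using h
    have h' := Finset.sum_congr rfl fun j (_ : j ∈ Finset.univ) =>
      Finset.sum_congr rfl fun l (_ : l ∈ Finset.univ) => h j l
    simp only [Finset.sum_add_distrib, ← Finset.mul_sum, Finset.sum_const, Finset.card_univ,
      Finset.sum_ite_eq, Finset.mem_univ, if_true, nsmul_eq_mul] at h'
    rw [Finset.sum_comm (f := fun j l => K (l, j) (j, l))] at h'
    linear_combination h'
  linear_combination (Fintype.card ι : ℂ) ^ 2 * key i k - (Fintype.card ι : ℂ) * key k i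

end Commutant

section Haar

theorem kronecker_self_mul_entry {ι : Type*} [Fintype ι] (G A : Matrix ι ι ℂ) (x q : ι × ι) :
    ((G * A) ⊗ₖ (G * A)) x q = ∑ z, (G ⊗ₖ G) x z * (A ⊗ₖ A) z q := by
  rw [mul_kronecker_mul, mul_apply]

variable {ι : Type*} [Fintype ι] [DecidableEq ι]

instance : SecondCountableTopology (unitaryGroup ι ℂ) :=
  haveI : SecondCountableTopology (Matrix ι ι ℂ) :=
    inferInstanceAs (SecondCountableTopology (ι → ι → ℂ))
  TopologicalSpace.Subtype.secondCountableTopology (unitaryGroup ι ℂ : Set (Matrix ι ι ℂ))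

instance : CompactSpace (unitaryGroup ι ℂ) := by
  apply isCompact_iff_compactSpace.mp
  apply IsCompact.of_isClosed_subset
    (isCompact_univ_pi fun _ : ι => isCompact_univ_pi fun _ : ι => isCompact_closedBall (0 : ℂ) 1)
  · have h : (unitaryGroup ι ℂ : Set (Matrix ι ι ℂ)) = {A | A * star A = 1} := by
      ext A
      exact mem_unitaryGroup_iff
    rw [h]
    exact isClosed_eq (by fun_prop) continuous_const
  · intro A hA i _ j _
    simpa using entry_norm_bound_of_unitary hA i j

theorem integrable_of_continuous {X E : Type*} [TopologicalSpace X] [CompactSpace X]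
    [MeasurableSpace X] [OpensMeasurableSpace X] [NormedAddCommGroup E] {μ : Measure X}
    [IsFiniteMeasure μ] {f : X → E} (hf : Continuous f) : Integrable f μ :=
  hf.integrable_of_hasCompactSupport (HasCompactSupport.of_compactSpace f)

theorem continuous_unitaryGroup_entry (i j : ι) :
    Continuous fun A : unitaryGroup ι ℂ => (A : Matrix ι ι ℂ) i j :=
  continuous_subtype_val.matrix_elem i j

/-- Matrix of second moments of the entries of a random unitary matrix. -/
def momentMatrix (μ : Measure (unitaryGroup ι ℂ)) (q s : ι × ι) : Matrix (ι × ι) (ι × ι) ℂ :=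
  Matrix.of fun x y => ∫ A : unitaryGroup ι ℂ, (A.1 ⊗ₖ A.1) x q * star ((A.1 ⊗ₖ A.1) y s) ∂μ

theorem continuous_moment (x q y s : ι × ι) : Continuous fun A : unitaryGroup ι ℂ =>
    (A.1 ⊗ₖ A.1) x q * star ((A.1 ⊗ₖ A.1) y s) := by
  simp only [kroneckerMap_apply]
  exact ((continuous_unitaryGroup_entry _ _).mul (continuous_unitaryGroup_entry _ _)).mul
    ((continuous_unitaryGroup_entry _ _).mul (continuous_unitaryGroup_entry _ _)).star

variable (μ : Measure (unitaryGroup ι ℂ)) [IsProbabilityMeasure μ]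

theorem commute_momentMatrix [μ.IsMulLeftInvariant] (q s : ι × ι) {G : Matrix ι ι ℂ}
    (hG : G ∈ unitaryGroup ι ℂ) : Commute (momentMatrix μ q s) (G ⊗ₖ G) := by
  have hint (x y : ι × ι) (c : ℂ) : Integrable (fun A : unitaryGroup ι ℂ =>
      c * ((A.1 ⊗ₖ A.1) x q * star ((A.1 ⊗ₖ A.1) y s))) μ :=
    (integrable_of_continuous (continuous_moment x q y s)).const_mul c
  ext x y
  calc (momentMatrix μ q s * (G ⊗ₖ G)) x y
      = ∫ A : unitaryGroup ι ℂ, (A.1 ⊗ₖ A.1) x q *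
          star (((Gᴴ * A.1) ⊗ₖ (Gᴴ * A.1)) y s) ∂μ := by
        rw [Matrix.mul_apply, Finset.sum_congr rfl fun z _ => mul_comm _ ((G ⊗ₖ G) z y)]
        simp only [momentMatrix, of_apply, ← integral_const_mul]
        rw [← integral_finsetSum _ fun z _ => hint x z _]
        congr 1 with A
        rw [kronecker_self_mul_entry, star_sum, Finset.mul_sum]
        refine Finset.sum_congr rfl fun z _ => ?_
        simp only [kroneckerMap_apply, conjTranspose_apply, star_mul', star_star]
        ring
    _ = ∫ A : unitaryGroup ι ℂ, ((G * A.1) ⊗ₖ (G * A.1)) x q *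
          star ((A.1 ⊗ₖ A.1) y s) ∂μ := by
        rw [← integral_mul_left_eq_self _ (⟨G, hG⟩ : unitaryGroup ι ℂ)]
        congr 1 with A
        have h : Gᴴ * (G * A.1) = A.1 := by
          rw [← mul_assoc, ← star_eq_conjTranspose, mem_unitaryGroup_iff'.mp hG, one_mul]
        simp only [Submonoid.coe_mul, h]
    _ = ((G ⊗ₖ G) * momentMatrix μ q s) x y := by
        rw [Matrix.mul_apply]
        simp only [momentMatrix, of_apply, ← integral_const_mul]
        rw [← integral_finsetSum _ fun z _ => hint z y _]
        congr 1 with A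
        rw [kronecker_self_mul_entry, Finset.sum_mul]
        simp only [mul_assoc]

theorem sum_entry_mul_star {A : Matrix ι ι ℂ} (hA : A ∈ unitaryGroup ι ℂ) (q s : ι) :
    ∑ x, A x q * star (A x s) = if q = s then 1 else 0 := by
  have h := congrFun (congrFun (mem_unitaryGroup_iff'.mp hA) s) q
  simp only [mul_apply, star_apply, one_apply] at h
  simpa [eq_comm, mul_comm] using h

theorem sum_momentMatrix (q s : ι × ι) :
    ∑ x, ∑ y, momentMatrix μ q s (x, y) (x, y) = if q = s then 1 else 0 := by
  have hint (x y : ι × ι) := integrable_of_continuous (μ := μ) (continuous_moment x q y s)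
  simp only [momentMatrix, of_apply]
  rw [Finset.sum_congr rfl fun x _ => (integral_finsetSum _ fun y _ => hint (x, y) (x, y)).symm,
    ← integral_finsetSum _ fun x _ => integrable_finsetSum _ fun y _ => hint (x, y) (x, y)]
  have h (A : unitaryGroup ι ℂ) : ∑ x, ∑ y,
      (A.1 ⊗ₖ A.1) (x, y) q * star ((A.1 ⊗ₖ A.1) (x, y) s) = if q = s then 1 else 0 := by
    calc _ = (∑ x, A.1 x q.1 * star (A.1 x s.1)) * ∑ y, A.1 y q.2 * star (A.1 y s.2) := by
          rw [Finset.sum_mul_sum]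
          refine Finset.sum_congr rfl fun x _ => Finset.sum_congr rfl fun y _ => ?_
          simp only [kroneckerMap_apply, star_mul']
          ring
      _ = _ := by
          rw [sum_entry_mul_star A.2, sum_entry_mul_star A.2]
          simp only [Prod.ext_iff, ite_and, mul_ite, mul_one, mul_zero]
          split_ifs <;> rfl
  simp only [h, integral_const, probReal_univ, one_smul]

theorem sum_momentMatrix_swap (q s : ι × ι) :
    ∑ x, ∑ y, momentMatrix μ q s (x, y) (y, x) = if q = s.swap then 1 else 0 := by
  rw [← sum_momentMatrix μ q s.swap]
  refine Finset.sum_congr rfl fun x _ => Finset.sum_congr rfl fun y _ => ?_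
  simp only [momentMatrix, of_apply, kroneckerMap_apply, Prod.fst_swap, Prod.snd_swap]
  congr 1 with A
  rw [mul_comm (A.1 y s.1)]

/-- Exchange of the two components of a pair, or not, depending on a Boolean. -/
def exchange (b : Bool) (p : ι × ι) : ι × ι := if b then p.swap else p

variable (ι) in
/-- Unnormalized second order Weingarten function of the unitary group. -/
def weingarten (a b : Bool) : ℂ :=
  if a = b then (Fintype.card ι : ℂ) ^ 2 else -(Fintype.card ι : ℂ)

theorem integral_kronecker_mul_star [μ.IsMulLeftInvariant] (p q r s : ι × ι) :
    ((Fintype.card ι : ℂ) ^ 4 - (Fintype.card ι : ℂ) ^ 2) *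
      ∫ A : unitaryGroup ι ℂ, (A.1 ⊗ₖ A.1) p q * star ((A.1 ⊗ₖ A.1) r s) ∂μ =
    ∑ a, ∑ b, weingarten ι a b * ((if exchange a p = r then 1 else 0) *
      (if exchange b q = s then 1 else 0)) := by
  have h := entry_of_commute_kronecker_self (fun G hG => commute_momentMatrix μ q s hG)
    p.1 p.2 r.1 r.2
  rw [sum_momentMatrix, sum_momentMatrix_swap] at h
  have e : (q = s.swap) = (q.swap = s) := by
    rw [eq_iff_iff, ← Prod.swap_inj, Prod.swap_swap]
  have e1 : (p.1 = r.1 ∧ p.2 = r.2) = (p = r) := by rw [Prod.ext_iff]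
  have e2 : (p.1 = r.2 ∧ p.2 = r.1) = (p.swap = r) := by simp [Prod.ext_iff, and_comm]
  simp only [e, e1, e2] at h
  refine h.trans ?_
  simp only [Fintype.sum_bool, weingarten, exchange, if_true, Bool.false_eq_true, if_false,
    Bool.true_eq_false]
  ring

end Haar

section LocalAverage

variable {ι : Type*}

theorem sum_fst_fst_snd_fst [Fintype ι] (f : ι → ι → ℂ) : ∑ p : (ι × ι) × (ι × ι),
    f p.1.1 p.2.1 = (Fintype.card ι : ℂ) ^ 2 * ∑ i, ∑ k, f i k := by
  simp only [Fintype.sum_prod_type, Finset.sum_const, Finset.card_univ, nsmul_eq_mul,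
    ← Finset.mul_sum]
  ring

theorem sum_fst_snd_snd_snd [Fintype ι] (f : ι → ι → ℂ) : ∑ p : (ι × ι) × (ι × ι),
    f p.1.2 p.2.2 = (Fintype.card ι : ℂ) ^ 2 * ∑ i, ∑ k, f i k := by
  simp only [Fintype.sum_prod_type, Finset.sum_const, Finset.card_univ, nsmul_eq_mul,
    ← Finset.mul_sum]
  ring

/-- On two copies of a bipartite index set, exchange the first legs of the copies if `a` holds and
the second legs if `b` holds. -/
def legSwap (a b : Bool) (p : (ι × ι) × (ι × ι)) : (ι × ι) × (ι × ι) :=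
  (((exchange a (p.1.1, p.2.1)).1, (exchange b (p.1.2, p.2.2)).1),
    ((exchange a (p.1.1, p.2.1)).2, (exchange b (p.1.2, p.2.2)).2))

theorem legSwap_legSwap (a b c d : Bool) (p : (ι × ι) × (ι × ι)) :
    legSwap a b (legSwap c d p) = legSwap (xor a c) (xor b d) p := by
  cases a <;> cases b <;> cases c <;> cases d <;> rfl

theorem legSwap_false (p : (ι × ι) × (ι × ι)) : legSwap false false p = p := rfl

theorem legSwap_eq_iff (a b : Bool) (p r : (ι × ι) × (ι × ι)) : legSwap a b p = r ↔
    exchange a (p.1.1, p.2.1) = (r.1.1, r.2.1) ∧ exchange b (p.1.2, p.2.2) = (r.1.2, r.2.2) := by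
  simp only [legSwap, Prod.ext_iff]
  tauto

theorem legSwap_eq_comm (a b : Bool) (p r : (ι × ι) × (ι × ι)) :
    legSwap a b p = r ↔ p = legSwap a b r := by
  constructor <;> rintro rfl <;> simp [legSwap_legSwap, legSwap_false]

theorem local_kronecker_apply (A B : Matrix ι ι ℂ) (p q : (ι × ι) × (ι × ι)) :
    ((A ⊗ₖ B) ⊗ₖ (A ⊗ₖ B)) p q = (A ⊗ₖ A) (p.1.1, p.2.1) (q.1.1, q.2.1) *
      (B ⊗ₖ B) (p.1.2, p.2.2) (q.1.2, q.2.2) := by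
  simp only [kroneckerMap_apply]
  ring

theorem trace_conj_mul {κ : Type*} [Fintype κ] (X M Q : Matrix κ κ ℂ) :
    (X * M * Xᴴ * Q).trace = ∑ x : κ × κ × κ × κ,
      X x.1 x.2.2.2 * star (X x.2.1 x.2.2.1) * (M x.2.2.2 x.2.2.1 * Q x.2.1 x.1) := by
  simp only [Fintype.sum_prod_type, trace, diag, Matrix.mul_apply, Finset.sum_mul,
    conjTranspose_apply]
  refine Finset.sum_congr rfl fun _ _ => Finset.sum_congr rfl fun _ _ =>
    Finset.sum_congr rfl fun _ _ => Finset.sum_congr rfl fun _ _ => ?_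
  ring

variable [DecidableEq ι]

variable (ι) in
/-- The operator exchanging the legs of two copies as in `legSwap`. -/
def swapMatrix (a b : Bool) : Matrix ((ι × ι) × (ι × ι)) ((ι × ι) × (ι × ι)) ℂ :=
  Matrix.of fun p q => if legSwap a b p = q then 1 else 0

theorem swapMatrix_false : swapMatrix ι false false = 1 := by
  ext p q
  rw [swapMatrix, of_apply, legSwap_false, one_apply]

variable [Fintype ι]

theorem swapMatrix_mul_apply (a b : Bool) (M : Matrix ((ι × ι) × (ι × ι)) ((ι × ι) × (ι × ι)) ℂ)
    (p q : (ι × ι) × (ι × ι)) : (swapMatrix ι a b * M) p q = M (legSwap a b p) q := by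
  rw [Matrix.mul_apply]
  simp [swapMatrix]

theorem mul_swapMatrix_apply (a b : Bool) (M : Matrix ((ι × ι) × (ι × ι)) ((ι × ι) × (ι × ι)) ℂ)
    (p q : (ι × ι) × (ι × ι)) : (M * swapMatrix ι a b) p q = M p (legSwap a b q) := by
  rw [Matrix.mul_apply]
  simp [swapMatrix, legSwap_eq_comm]

theorem swapMatrix_mul_swapMatrix (a b c d : Bool) :
    swapMatrix ι a b * swapMatrix ι c d = swapMatrix ι (xor a c) (xor b d) := by
  ext p q
  rw [swapMatrix_mul_apply, swapMatrix, swapMatrix, of_apply, of_apply, legSwap_legSwap,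
    Bool.xor_comm a c, Bool.xor_comm b d]

theorem swapMatrix_true_mul_kronecker (U : Matrix (ι × ι) (ι × ι) ℂ) :
    swapMatrix ι true true * (U ⊗ₖ U) = (U ⊗ₖ U) * swapMatrix ι true true := by
  ext p q
  rw [swapMatrix_mul_apply, mul_swapMatrix_apply]
  simp [legSwap, exchange, mul_comm]

theorem trace_swapMatrix_true_false :
    (swapMatrix ι true false).trace = (Fintype.card ι : ℂ) ^ 3 := by
  have h (p : (ι × ι) × (ι × ι)) : legSwap true false p = p ↔ p.1.1 = p.2.1 := by
    rw [legSwap_eq_iff]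
    simp [exchange, eq_comm]
  calc (swapMatrix ι true false).trace
      = ∑ p : (ι × ι) × (ι × ι), if p.1.1 = p.2.1 then 1 else 0 :=
        Finset.sum_congr rfl fun p _ => if_congr (h p) rfl rfl
    _ = (Fintype.card ι : ℂ) ^ 3 := by
        rw [sum_fst_fst_snd_fst fun i k => if i = k then 1 else 0]
        simp only [Finset.sum_ite_eq, Finset.mem_univ, if_true, Finset.sum_const,
          Finset.card_univ, nsmul_eq_mul, mul_one]
        ring

theorem trace_swapMatrix_false_true :
    (swapMatrix ι false true).trace = (Fintype.card ι : ℂ) ^ 3 := by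
  have h (p : (ι × ι) × (ι × ι)) : legSwap false true p = p ↔ p.1.2 = p.2.2 := by
    rw [legSwap_eq_iff]
    simp [exchange, eq_comm]
  calc (swapMatrix ι false true).trace
      = ∑ p : (ι × ι) × (ι × ι), if p.1.2 = p.2.2 then 1 else 0 :=
        Finset.sum_congr rfl fun p _ => if_congr (h p) rfl rfl
    _ = (Fintype.card ι : ℂ) ^ 3 := by
        rw [sum_fst_snd_snd_snd fun i k => if i = k then 1 else 0]
        simp only [Finset.sum_ite_eq, Finset.mem_univ, if_true, Finset.sum_const,
          Finset.card_univ, nsmul_eq_mul, mul_one]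
        ring

variable (μ : Measure (unitaryGroup ι ℂ)) [IsProbabilityMeasure μ] [μ.IsMulLeftInvariant]

theorem integral_local_moment (p q r s : (ι × ι) × (ι × ι)) :
    ((Fintype.card ι : ℂ) ^ 4 - (Fintype.card ι : ℂ) ^ 2) ^ 2 *
      ∫ w : unitaryGroup ι ℂ × unitaryGroup ι ℂ,
        ((w.1.1 ⊗ₖ w.2.1) ⊗ₖ (w.1.1 ⊗ₖ w.2.1)) p q *
          star (((w.1.1 ⊗ₖ w.2.1) ⊗ₖ (w.1.1 ⊗ₖ w.2.1)) r s) ∂(μ.prod μ) =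
    ∑ k : Bool × Bool × Bool × Bool, weingarten ι k.1 k.2.2.1 * weingarten ι k.2.1 k.2.2.2 *
      ((if legSwap k.1 k.2.1 p = r then 1 else 0) *
        (if legSwap k.2.2.1 k.2.2.2 q = s then 1 else 0)) := by
  have h := integral_prod_mul (μ := μ) (ν := μ)
    (fun A : unitaryGroup ι ℂ => (A.1 ⊗ₖ A.1) (p.1.1, p.2.1) (q.1.1, q.2.1) *
      star ((A.1 ⊗ₖ A.1) (r.1.1, r.2.1) (s.1.1, s.2.1)))
    (fun B : unitaryGroup ι ℂ => (B.1 ⊗ₖ B.1) (p.1.2, p.2.2) (q.1.2, q.2.2) *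
      star ((B.1 ⊗ₖ B.1) (r.1.2, r.2.2) (s.1.2, s.2.2)))
  have e : ∀ w : unitaryGroup ι ℂ × unitaryGroup ι ℂ,
      ((w.1.1 ⊗ₖ w.2.1) ⊗ₖ (w.1.1 ⊗ₖ w.2.1)) p q *
          star (((w.1.1 ⊗ₖ w.2.1) ⊗ₖ (w.1.1 ⊗ₖ w.2.1)) r s) =
        ((w.1.1 ⊗ₖ w.1.1) (p.1.1, p.2.1) (q.1.1, q.2.1) *
          star ((w.1.1 ⊗ₖ w.1.1) (r.1.1, r.2.1) (s.1.1, s.2.1))) *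
        ((w.2.1 ⊗ₖ w.2.1) (p.1.2, p.2.2) (q.1.2, q.2.2) *
          star ((w.2.1 ⊗ₖ w.2.1) (r.1.2, r.2.2) (s.1.2, s.2.2))) := fun w => by
    rw [local_kronecker_apply, local_kronecker_apply, star_mul', mul_mul_mul_comm]
  have hif (P Q : Prop) [Decidable P] [Decidable Q] :
      (if P ∧ Q then 1 else 0 : ℂ) = (if P then 1 else 0) * (if Q then 1 else 0) := by
    rw [ite_and, ite_mul, one_mul, zero_mul]
  simp only [e]
  rw [h, sq, mul_mul_mul_comm, integral_kronecker_mul_star, integral_kronecker_mul_star]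
  simp only [legSwap_eq_iff, hif, Fintype.sum_prod_type, Fintype.sum_bool]
  ring

theorem sum_ite_mul_ite {κ : Type*} [Fintype κ] [DecidableEq κ] (f g : κ → κ) (w : ℂ)
    (M Q : Matrix κ κ ℂ) :
    ∑ x : κ × κ × κ × κ, w * ((if f x.1 = x.2.1 then 1 else 0) *
        (if g x.2.2.2 = x.2.2.1 then 1 else 0)) * (M x.2.2.2 x.2.2.1 * Q x.2.1 x.1) =
      w * ((∑ p, Q (f p) p) * ∑ q, M q (g q)) := by
  have h1 : ∑ p, Q (f p) p = ∑ p, ∑ r, (if f p = r then 1 else 0) * Q r p := by simp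
  have h2 : ∑ q, M q (g q) = ∑ s, ∑ q, (if g q = s then 1 else 0) * M q s := by
    rw [Finset.sum_comm]
    simp
  rw [mul_comm (∑ p, Q (f p) p)]
  simp only [h1, h2, Fintype.sum_prod_type, Finset.sum_mul, Finset.mul_sum]
  refine Finset.sum_congr rfl fun _ _ => Finset.sum_congr rfl fun _ _ =>
    Finset.sum_congr rfl fun _ _ => Finset.sum_congr rfl fun _ _ => ?_
  ring

theorem sum_ite_legSwap_mul (a b a' b' : Bool) (w : ℂ)
    (M Q : Matrix ((ι × ι) × (ι × ι)) ((ι × ι) × (ι × ι)) ℂ) :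
    ∑ x : ((ι × ι) × (ι × ι)) × ((ι × ι) × (ι × ι)) × ((ι × ι) × (ι × ι)) × ((ι × ι) × (ι × ι)),
      w * ((if legSwap a b x.1 = x.2.1 then 1 else 0) *
        (if legSwap a' b' x.2.2.2 = x.2.2.1 then 1 else 0)) *
          (M x.2.2.2 x.2.2.1 * Q x.2.1 x.1) =
    w * ((swapMatrix ι a b * Q).trace * (M * swapMatrix ι a' b').trace) := by
  rw [sum_ite_mul_ite]
  simp only [trace, diag, swapMatrix_mul_apply, mul_swapMatrix_apply]

/-- Average of a two-copy correlation function over local gates. -/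
theorem integral_trace_local (M Q : Matrix ((ι × ι) × (ι × ι)) ((ι × ι) × (ι × ι)) ℂ) :
    ((Fintype.card ι : ℂ) ^ 4 - (Fintype.card ι : ℂ) ^ 2) ^ 2 *
      ∫ w : unitaryGroup ι ℂ × unitaryGroup ι ℂ,
        (((w.1.1 ⊗ₖ w.2.1) ⊗ₖ (w.1.1 ⊗ₖ w.2.1)) * M *
          ((w.1.1 ⊗ₖ w.2.1) ⊗ₖ (w.1.1 ⊗ₖ w.2.1))ᴴ * Q).trace ∂(μ.prod μ) =
    ∑ k : Bool × Bool × Bool × Bool, weingarten ι k.1 k.2.2.1 * weingarten ι k.2.1 k.2.2.2 *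
      ((swapMatrix ι k.1 k.2.1 * Q).trace * (M * swapMatrix ι k.2.2.1 k.2.2.2).trace) := by
  have hcont (p q : (ι × ι) × (ι × ι)) : Continuous fun w : unitaryGroup ι ℂ × unitaryGroup ι ℂ =>
      ((w.1.1 ⊗ₖ w.2.1) ⊗ₖ (w.1.1 ⊗ₖ w.2.1)) p q := by
    simp only [kroneckerMap_apply]
    have h1 (i j : ι) : Continuous fun w : unitaryGroup ι ℂ × unitaryGroup ι ℂ => w.1.1 i j :=
      (continuous_unitaryGroup_entry i j).comp continuous_fst
    have h2 (i j : ι) : Continuous fun w : unitaryGroup ι ℂ × unitaryGroup ι ℂ => w.2.1 i j :=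
      (continuous_unitaryGroup_entry i j).comp continuous_snd
    exact ((h1 _ _).mul (h2 _ _)).mul ((h1 _ _).mul (h2 _ _))
  have hint (p q r s : (ι × ι) × (ι × ι)) (z : ℂ) :
      Integrable (fun w : unitaryGroup ι ℂ × unitaryGroup ι ℂ =>
        ((w.1.1 ⊗ₖ w.2.1) ⊗ₖ (w.1.1 ⊗ₖ w.2.1)) p q *
          star (((w.1.1 ⊗ₖ w.2.1) ⊗ₖ (w.1.1 ⊗ₖ w.2.1)) r s) * z) (μ.prod μ) :=
    integrable_of_continuous (((hcont _ _).mul (hcont _ _).star).mul continuous_const)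
  simp only [trace_conj_mul]
  rw [integral_finsetSum _ fun x _ => hint _ _ _ _ _, Finset.mul_sum]
  simp only [integral_mul_const, ← mul_assoc (((Fintype.card ι : ℂ) ^ 4 - _) ^ 2)]
  simp only [integral_local_moment, ← sum_ite_legSwap_mul, Finset.sum_mul]
  exact Finset.sum_comm

end LocalAverage

section SwapCorrelation

variable {ι : Type*} [Fintype ι] [DecidableEq ι]

/-- Sum of the correlations of the exchange of the first legs of two copies, evolved by `U`, with
the exchanges of the first and of the second legs. -/
def swapCorrelation (U : Matrix (ι × ι) (ι × ι) ℂ) : ℂ :=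
  ((U ⊗ₖ U) * swapMatrix ι true false * (U ⊗ₖ U)ᴴ *
    (swapMatrix ι true false + swapMatrix ι false true)).trace

theorem kronecker_self_mem_unitaryGroup {κ : Type*} [Fintype κ] [DecidableEq κ]
    {U : Matrix κ κ ℂ} (hU : U ∈ unitaryGroup κ ℂ) :
    (U ⊗ₖ U) * (U ⊗ₖ U)ᴴ = 1 ∧ (U ⊗ₖ U)ᴴ * (U ⊗ₖ U) = 1 := by
  have h1 : U * Uᴴ = 1 := mem_unitaryGroup_iff.mp hU
  have h2 : Uᴴ * U = 1 := mem_unitaryGroup_iff'.mp hU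
  rw [conjTranspose_kronecker, ← mul_kronecker_mul, ← mul_kronecker_mul, h1, h2, one_kronecker_one]
  exact ⟨rfl, rfl⟩

theorem swapMatrix_true_mul_kronecker_conjTranspose (U : Matrix (ι × ι) (ι × ι) ℂ) :
    swapMatrix ι true true * (U ⊗ₖ U)ᴴ = (U ⊗ₖ U)ᴴ * swapMatrix ι true true := by
  rw [conjTranspose_kronecker, swapMatrix_true_mul_kronecker]

theorem swapMatrix_true_mul_add :
    swapMatrix ι true true * (swapMatrix ι true false + swapMatrix ι false true) =
      swapMatrix ι true false + swapMatrix ι false true := by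
  rw [Matrix.mul_add, swapMatrix_mul_swapMatrix, swapMatrix_mul_swapMatrix, add_comm]
  rfl

theorem trace_swapMatrix_mul_conj {U : Matrix (ι × ι) (ι × ι) ℂ}
    (hU : U ∈ unitaryGroup (ι × ι) ℂ) (a b : Bool) :
    (swapMatrix ι a b * ((U ⊗ₖ U)ᴴ * (swapMatrix ι true false + swapMatrix ι false true) *
      (U ⊗ₖ U))).trace =
      if a = b then 2 * (Fintype.card ι : ℂ) ^ 3 else swapCorrelation U := by
  have hu := (kronecker_self_mem_unitaryGroup hU).1
  have hdiag : ((U ⊗ₖ U)ᴴ * (swapMatrix ι true false + swapMatrix ι false true) *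
      (U ⊗ₖ U)).trace = 2 * (Fintype.card ι : ℂ) ^ 3 := by
    rw [trace_mul_comm, ← mul_assoc, hu, one_mul, trace_add, trace_swapMatrix_true_false,
      trace_swapMatrix_false_true, two_mul]
  have hoff : (swapMatrix ι true false * ((U ⊗ₖ U)ᴴ *
      (swapMatrix ι true false + swapMatrix ι false true) * (U ⊗ₖ U))).trace =
      swapCorrelation U := by
    rw [swapCorrelation, ← mul_assoc, trace_mul_comm]
    simp only [mul_assoc]
  have hcomm : swapMatrix ι true true * ((U ⊗ₖ U)ᴴ *
      (swapMatrix ι true false + swapMatrix ι false true) * (U ⊗ₖ U)) =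
      (U ⊗ₖ U)ᴴ * (swapMatrix ι true false + swapMatrix ι false true) * (U ⊗ₖ U) := by
    rw [← mul_assoc, ← mul_assoc, swapMatrix_true_mul_kronecker_conjTranspose,
      mul_assoc _ (swapMatrix ι true true), swapMatrix_true_mul_add]
  cases a <;> cases b
  · rw [swapMatrix_false, one_mul, hdiag, if_pos rfl]
  · have h : swapMatrix ι false true = swapMatrix ι true false * swapMatrix ι true true :=
      (swapMatrix_mul_swapMatrix true false true true).symm
    rw [if_neg Bool.false_ne_true, ← hoff]
    nth_rewrite 1 [h]
    rw [mul_assoc, hcomm]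
  · rw [hoff, if_neg (Ne.symm Bool.false_ne_true)]
  · rw [hcomm, hdiag, if_pos rfl]

theorem trace_conj_mul_swapMatrix {V : Matrix (ι × ι) (ι × ι) ℂ}
    (hV : V ∈ unitaryGroup (ι × ι) ℂ) (a : Bool) :
    ((V ⊗ₖ V) * swapMatrix ι true false * (V ⊗ₖ V)ᴴ * swapMatrix ι a a).trace =
      (Fintype.card ι : ℂ) ^ 3 := by
  have hv := (kronecker_self_mem_unitaryGroup hV).2
  cases a
  · rw [swapMatrix_false, mul_one, trace_mul_comm, ← mul_assoc, hv, one_mul,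
      trace_swapMatrix_true_false]
  · rw [mul_assoc, ← swapMatrix_true_mul_kronecker_conjTranspose, ← mul_assoc, trace_mul_comm,
      mul_assoc, ← mul_assoc, hv, one_mul, swapMatrix_mul_swapMatrix]
    exact trace_swapMatrix_false_true

theorem trace_conj_mul_swapMatrix_add (V : Matrix (ι × ι) (ι × ι) ℂ) :
    ((V ⊗ₖ V) * swapMatrix ι true false * (V ⊗ₖ V)ᴴ * swapMatrix ι true false).trace +
      ((V ⊗ₖ V) * swapMatrix ι true false * (V ⊗ₖ V)ᴴ * swapMatrix ι false true).trace =
      swapCorrelation V := by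
  rw [swapCorrelation, Matrix.mul_add, trace_add]

theorem swapCorrelation_mul_mul (U W V : Matrix (ι × ι) (ι × ι) ℂ) :
    swapCorrelation (U * W * V) =
      ((W ⊗ₖ W) * ((V ⊗ₖ V) * swapMatrix ι true false * (V ⊗ₖ V)ᴴ) * (W ⊗ₖ W)ᴴ *
        ((U ⊗ₖ U)ᴴ * (swapMatrix ι true false + swapMatrix ι false true) * (U ⊗ₖ U))).trace := by
  simp only [swapCorrelation, mul_kronecker_mul, conjTranspose_mul, mul_assoc]
  rw [trace_mul_comm]
  simp only [mul_assoc]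

theorem integral_swapCorrelation (μ : Measure (unitaryGroup ι ℂ)) [IsProbabilityMeasure μ]
    [μ.IsMulLeftInvariant] {U V : Matrix (ι × ι) (ι × ι) ℂ} (hU : U ∈ unitaryGroup (ι × ι) ℂ)
    (hV : V ∈ unitaryGroup (ι × ι) ℂ) :
    ((Fintype.card ι : ℂ) ^ 4 - (Fintype.card ι : ℂ) ^ 2) ^ 2 *
      ∫ w : unitaryGroup ι ℂ × unitaryGroup ι ℂ,
        swapCorrelation (U * (w.1.1 ⊗ₖ w.2.1) * V) ∂(μ.prod μ) =
    4 * (Fintype.card ι : ℂ) ^ 8 * ((Fintype.card ι : ℂ) ^ 2 + 1) -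
      4 * (Fintype.card ι : ℂ) ^ 6 * (swapCorrelation U + swapCorrelation V) +
      (Fintype.card ι : ℂ) ^ 2 * ((Fintype.card ι : ℂ) ^ 2 + 1) *
        (swapCorrelation U * swapCorrelation V) := by
  simp only [swapCorrelation_mul_mul U _ V]
  rw [integral_trace_local, ← trace_conj_mul_swapMatrix_add V]
  simp only [trace_swapMatrix_mul_conj hU, Fintype.sum_prod_type, Fintype.sum_bool,
    trace_conj_mul_swapMatrix hV, weingarten, if_true, Bool.false_eq_true, if_false,
    Bool.true_eq_false]
  ring

end SwapCorrelation

section Purity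

theorem trace_mul_conjTranspose_sq {m n : Type*} [Fintype m] [Fintype n] (X : Matrix m n ℂ) :
    ((X * Xᴴ) * (X * Xᴴ)).trace = ∑ x : (m × n) × (m × n),
      X x.1.1 x.1.2 * star (X x.2.1 x.1.2) * (X x.2.1 x.2.2 * star (X x.1.1 x.2.2)) := by
  simp only [Fintype.sum_prod_type, trace, diag, Matrix.mul_apply, Finset.sum_mul_sum,
    conjTranspose_apply]
  exact Finset.sum_congr rfl fun _ _ => Finset.sum_comm

theorem trace_conj_swapMatrix {ι : Type*} [Fintype ι] [DecidableEq ι]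
    (U : Matrix (ι × ι) (ι × ι) ℂ) (a b c d : Bool) :
    ((U ⊗ₖ U) * swapMatrix ι a b * (U ⊗ₖ U)ᴴ * swapMatrix ι c d).trace =
      ∑ x : ((ι × ι) × (ι × ι)) × ((ι × ι) × (ι × ι)), (U ⊗ₖ U) x.1 x.2 *
        star ((U ⊗ₖ U) (legSwap c d x.1) (legSwap a b x.2)) := by
  rw [mul_assoc, mul_assoc, Fintype.sum_prod_type, trace]
  refine Finset.sum_congr rfl fun p _ => ?_
  rw [diag, Matrix.mul_apply]
  refine Finset.sum_congr rfl fun q _ => ?_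
  rw [swapMatrix_mul_apply, mul_swapMatrix_apply, conjTranspose_apply]

theorem ofReal_re_trace_sq {m : Type*} [Fintype m] {H : Matrix m m ℂ} (hH : H.IsHermitian) :
    (((H * H).trace.re : ℝ) : ℂ) = (H * H).trace := by
  rw [← Complex.conj_eq_iff_re]
  change star (H * H).trace = _
  rw [← trace_conjTranspose, conjTranspose_mul, hH.eq]

variable {N : ℕ} (U : Matrix (Fin N × Fin N) (Fin N × Fin N) ℂ)

theorem isHermitian_rhoR : (rhoR N U).IsHermitian := by
  rw [IsHermitian, rhoR, conjTranspose_smul, conjTranspose_mul, conjTranspose_conjTranspose]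
  simp

theorem swapGate_mul_swapGate : swapGate N * swapGate N = 1 := by
  ext p q
  rw [Matrix.mul_apply, Fintype.sum_prod_type, one_apply]
  simp [swapGate, ite_and, Prod.ext_iff, eq_comm]

theorem conjTranspose_swapGate : (swapGate N)ᴴ = swapGate N := by
  ext p q
  simp [swapGate, eq_comm, and_comm]

theorem isHermitian_rhoT : (rhoT N U).IsHermitian := by
  rw [IsHermitian, rhoT, conjTranspose_smul, conjTranspose_mul, conjTranspose_mul,
    conjTranspose_mul, conjTranspose_conjTranspose, conjTranspose_swapGate, mul_assoc]
  simp [mul_assoc]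

theorem ofReal_Xpur : (Xpur N U : ℂ) = ((N : ℂ) ^ 4)⁻¹ *
    ((U ⊗ₖ U) * swapMatrix (Fin N) true false * (U ⊗ₖ U)ᴴ *
      swapMatrix (Fin N) true false).trace := by
  have e : (((N : ℂ) ^ 2)⁻¹) * (((N : ℂ) ^ 2)⁻¹) = ((N : ℂ) ^ 4)⁻¹ := by
    rw [← mul_inv, ← pow_add]
  rw [Xpur, ofReal_re_trace_sq (isHermitian_rhoR U), rhoR, smul_mul_smul_comm, trace_smul, e,
    smul_eq_mul, trace_mul_conjTranspose_sq, trace_conj_swapMatrix]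
  congr 1
  let f : ((Fin N × Fin N) × (Fin N × Fin N)) × ((Fin N × Fin N) × (Fin N × Fin N)) →
      ((Fin N × Fin N) × (Fin N × Fin N)) × ((Fin N × Fin N) × (Fin N × Fin N)) :=
    fun x => (((x.1.1.1, x.1.2.1), (x.2.1.1, x.2.2.1)), ((x.1.1.2, x.1.2.2), (x.2.1.2, x.2.2.2)))
  let g : ((Fin N × Fin N) × (Fin N × Fin N)) × ((Fin N × Fin N) × (Fin N × Fin N)) →
      ((Fin N × Fin N) × (Fin N × Fin N)) × ((Fin N × Fin N) × (Fin N × Fin N)) :=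
    fun x => (((x.1.1.1, x.2.1.1), (x.1.1.2, x.2.1.2)), ((x.1.2.1, x.2.2.1), (x.1.2.2, x.2.2.2)))
  refine Fintype.sum_equiv ⟨f, g, fun _ => rfl, fun _ => rfl⟩ _ _ fun x => ?_
  simp only [f, reshuffle, of_apply, legSwap, exchange, kroneckerMap_apply, Equiv.coe_fn_mk,
    if_true, Bool.false_eq_true, if_false, Prod.swap, star_mul']
  ring

theorem ofReal_Ypur : (Ypur N U : ℂ) = ((N : ℂ) ^ 4)⁻¹ *
    ((U ⊗ₖ U) * swapMatrix (Fin N) true false * (U ⊗ₖ U)ᴴ *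
      swapMatrix (Fin N) false true).trace := by
  have e : (((N : ℂ) ^ 2)⁻¹) * (((N : ℂ) ^ 2)⁻¹) = ((N : ℂ) ^ 4)⁻¹ := by
    rw [← mul_inv, ← pow_add]
  have hS (G : Matrix (Fin N × Fin N) (Fin N × Fin N) ℂ) :
      (swapGate N * G * swapGate N * (swapGate N * G * swapGate N)).trace = (G * G).trace := by
    rw [trace_mul_comm]
    simp only [mul_assoc]
    rw [trace_mul_comm]
    simp only [mul_assoc, swapGate_mul_swapGate, mul_one]
    rw [← mul_assoc (swapGate N) (swapGate N), swapGate_mul_swapGate, one_mul]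
  rw [Ypur, ofReal_re_trace_sq (isHermitian_rhoT U), rhoT, smul_mul_smul_comm, trace_smul, e,
    smul_eq_mul, hS, trace_mul_conjTranspose_sq, trace_conj_swapMatrix]
  congr 1
  let f : ((Fin N × Fin N) × (Fin N × Fin N)) × ((Fin N × Fin N) × (Fin N × Fin N)) →
      ((Fin N × Fin N) × (Fin N × Fin N)) × ((Fin N × Fin N) × (Fin N × Fin N)) :=
    fun x => (((x.1.2.1, x.1.1.2), (x.2.2.1, x.2.1.2)), ((x.1.1.1, x.1.2.2), (x.2.1.1, x.2.2.2)))
  let g : ((Fin N × Fin N) × (Fin N × Fin N)) × ((Fin N × Fin N) × (Fin N × Fin N)) →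
      ((Fin N × Fin N) × (Fin N × Fin N)) × ((Fin N × Fin N) × (Fin N × Fin N)) :=
    fun x => (((x.2.1.1, x.1.1.2), (x.1.1.1, x.2.1.2)), ((x.2.2.1, x.1.2.2), (x.1.2.1, x.2.2.2)))
  refine Fintype.sum_equiv ⟨f, g, fun _ => rfl, fun _ => rfl⟩ _ _ fun x => ?_
  simp only [f, ptransp, of_apply, legSwap, exchange, kroneckerMap_apply, Equiv.coe_fn_mk,
    if_true, Bool.false_eq_true, if_false, Prod.swap, star_mul']
  ring

theorem ofReal_Xpur_add_Ypur :
    ((Xpur N U + Ypur N U : ℝ) : ℂ) = ((N : ℂ) ^ 4)⁻¹ * swapCorrelation U := by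
  rw [Complex.ofReal_add, ofReal_Xpur, ofReal_Ypur, ← mul_add, trace_conj_mul_swapMatrix_add]

theorem continuous_Xpur : Continuous (Xpur N) := by
  have hR : Continuous (reshuffle N) :=
    continuous_matrix fun i j => continuous_id.matrix_elem (i.1, j.1) (i.2, j.2)
  have h : Continuous (rhoR N) :=
    (continuous_const_smul _).comp (hR.matrix_mul hR.matrix_conjTranspose)
  exact Complex.continuous_re.comp (h.matrix_mul h).matrix_trace

theorem continuous_Ypur : Continuous (Ypur N) := by
  have hT : Continuous (ptransp N) :=
    continuous_matrix fun i j => continuous_id.matrix_elem (j.1, i.2) (i.1, j.2)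
  have h : Continuous (rhoT N) := (continuous_const_smul _).comp
    ((continuous_const.matrix_mul (hT.matrix_mul hT.matrix_conjTranspose)).matrix_mul
      continuous_const)
  exact Complex.continuous_re.comp (h.matrix_mul h).matrix_trace

theorem continuous_ep : Continuous (ep N) :=
  continuous_const.mul (((continuous_const.sub continuous_Xpur).add
    (continuous_const.sub continuous_Ypur)).sub continuous_const)

theorem continuous_local_kronecker :
    Continuous fun w : unitaryGroup (Fin N) ℂ × unitaryGroup (Fin N) ℂ => w.1.1 ⊗ₖ w.2.1 :=
  continuous_matrix fun _ _ => ((continuous_unitaryGroup_entry _ _).comp continuous_fst).mul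
    ((continuous_unitaryGroup_entry _ _).comp continuous_snd)

theorem one_sub_ep_div_epBar (hN : 2 ≤ N) : 1 - ep N U / epBar N =
    (((N : ℝ) ^ 2 * ((N : ℝ) ^ 2 + 1)) * (Xpur N U + Ypur N U) - 4 * (N : ℝ) ^ 2) /
      ((N : ℝ) ^ 2 - 1) ^ 2 := by
  have hN' : (2 : ℝ) ≤ N := by exact_mod_cast hN
  have h0 : (N : ℝ) ≠ 0 := by linarith
  have h1 : (N : ℝ) - 1 ≠ 0 := by linarith
  have h2 : (N : ℝ) + 1 ≠ 0 := by linarith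
  have h3 : (N : ℝ) ^ 2 + 1 ≠ 0 := by positivity
  have h4 : (N : ℝ) ^ 2 - 1 = (N - 1) * (N + 1) := by ring
  rw [ep, epBar, h4]
  field_simp
  ring

variable (μ : Measure (unitaryGroup (Fin N) ℂ)) [IsProbabilityMeasure μ] [μ.IsMulLeftInvariant]

theorem integral_Xpur_add_Ypur (hN : 2 ≤ N)
    {U V : Matrix (Fin N × Fin N) (Fin N × Fin N) ℂ} (hU : U ∈ unitaryGroup (Fin N × Fin N) ℂ)
    (hV : V ∈ unitaryGroup (Fin N × Fin N) ℂ) :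
    ((N : ℝ) ^ 2 - 1) ^ 2 * ∫ w : unitaryGroup (Fin N) ℂ × unitaryGroup (Fin N) ℂ,
        (Xpur N (U * (w.1.1 ⊗ₖ w.2.1) * V) + Ypur N (U * (w.1.1 ⊗ₖ w.2.1) * V)) ∂(μ.prod μ) =
      4 * ((N : ℝ) ^ 2 + 1) - 4 * (N : ℝ) ^ 2 * ((Xpur N U + Ypur N U) + (Xpur N V + Ypur N V)) +
      (N : ℝ) ^ 2 * ((N : ℝ) ^ 2 + 1) * ((Xpur N U + Ypur N U) * (Xpur N V + Ypur N V)) := by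
  have hN0 : (N : ℂ) ≠ 0 := by
    rw [Nat.cast_ne_zero]
    lia
  have hz (U : Matrix (Fin N × Fin N) (Fin N × Fin N) ℂ) :
      swapCorrelation U = (N : ℂ) ^ 4 * ((Xpur N U + Ypur N U : ℝ) : ℂ) := by
    rw [ofReal_Xpur_add_Ypur, mul_inv_cancel_left₀ (pow_ne_zero 4 hN0)]
  have h := integral_swapCorrelation μ hU hV
  simp only [hz, Fintype.card_fin, integral_const_mul, integral_complex_ofReal] at h
  apply Complex.ofReal_injective
  apply mul_left_cancel₀ (pow_ne_zero 8 hN0)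
  simp only [Complex.ofReal_mul, Complex.ofReal_add, Complex.ofReal_sub, Complex.ofReal_pow,
    Complex.ofReal_natCast, Complex.ofReal_one, Complex.ofReal_ofNat] at h ⊢
  linear_combination h

/-- The complement of the normalized entangling power is multiplicative under averaging over an
intermediate local gate. -/
theorem integral_one_sub_ep_div_epBar (hN : 2 ≤ N)
    {U V : Matrix (Fin N × Fin N) (Fin N × Fin N) ℂ} (hU : U ∈ unitaryGroup (Fin N × Fin N) ℂ)
    (hV : V ∈ unitaryGroup (Fin N × Fin N) ℂ) :
    ∫ w : unitaryGroup (Fin N) ℂ × unitaryGroup (Fin N) ℂ,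
        (1 - ep N (U * (w.1.1 ⊗ₖ w.2.1) * V) / epBar N) ∂(μ.prod μ) =
      (1 - ep N U / epBar N) * (1 - ep N V / epBar N) := by
  have hN' : (2 : ℝ) ≤ N := by exact_mod_cast hN
  have h0 : (N : ℝ) ^ 2 - 1 ≠ 0 := by nlinarith
  have hc : Continuous fun w : unitaryGroup (Fin N) ℂ × unitaryGroup (Fin N) ℂ =>
      U * (w.1.1 ⊗ₖ w.2.1) * V :=
    (continuous_const.matrix_mul continuous_local_kronecker).matrix_mul continuous_const
  have hi : Integrable (fun w : unitaryGroup (Fin N) ℂ × unitaryGroup (Fin N) ℂ =>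
      ((N : ℝ) ^ 2 * ((N : ℝ) ^ 2 + 1)) *
        (Xpur N (U * (w.1.1 ⊗ₖ w.2.1) * V) + Ypur N (U * (w.1.1 ⊗ₖ w.2.1) * V))) (μ.prod μ) :=
    integrable_of_continuous
      (continuous_const.mul ((continuous_Xpur.comp hc).add (continuous_Ypur.comp hc)))
  have h := integral_Xpur_add_Ypur μ hN hU hV
  simp only [one_sub_ep_div_epBar _ hN]
  rw [integral_div, integral_sub hi (integrable_const _), integral_const_mul, integral_const,
    probReal_univ, one_smul, div_mul_div_comm, div_eq_div_iff (pow_ne_zero 2 h0)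
      (mul_ne_zero (pow_ne_zero 2 h0) (pow_ne_zero 2 h0))]
  linear_combination (((N : ℝ) ^ 2 * ((N : ℝ) ^ 2 + 1)) * ((N : ℝ) ^ 2 - 1) ^ 2) * h

end Purity

section Chain

theorem chainGate_congr {D : Type*} [Fintype D] [DecidableEq D] (Us : ℕ → Matrix D D ℂ)
    {W W' : ℕ → Matrix D D ℂ} {m : ℕ} (h : ∀ k < m, W k = W' k) :
    chainGate Us W m = chainGate Us W' m := by
  induction m with
  | zero => rfl
  | succ m ih =>
    rw [chainGate, chainGate, h m m.lt_succ_self, ih fun k hk => h k (Nat.lt_succ_of_lt hk)]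

theorem chainGate_mem_unitaryGroup {D : Type*} [Fintype D] [DecidableEq D]
    {Us W : ℕ → Matrix D D ℂ} {m : ℕ} (hU : ∀ k ≤ m, Us k ∈ unitaryGroup D ℂ)
    (hW : ∀ k < m, W k ∈ unitaryGroup D ℂ) : chainGate Us W m ∈ unitaryGroup D ℂ := by
  induction m with
  | zero => exact hU 0 le_rfl
  | succ m ih =>
    exact mul_mem (mul_mem (hU _ le_rfl) (hW m m.lt_succ_self))
      (ih (fun k hk => hU k (Nat.le_succ_of_le hk)) fun k hk => hW k (Nat.lt_succ_of_lt hk))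

theorem continuous_chainGate {X D : Type*} [TopologicalSpace X] [Fintype D] [DecidableEq D]
    (Us : ℕ → Matrix D D ℂ) {W : X → ℕ → Matrix D D ℂ} {m : ℕ}
    (hW : ∀ k < m, Continuous fun x => W x k) : Continuous fun x => chainGate Us (W x) m := by
  induction m with
  | zero => exact continuous_const
  | succ m ih =>
    exact (continuous_const.matrix_mul (hW m m.lt_succ_self)).matrix_mul
      (ih fun k hk => hW k (Nat.lt_succ_of_lt hk))

variable {N : ℕ}

/-- The sequence of local gates determined by finitely many pairs of local unitaries, extended by
the identity. -/
def localGates {m : ℕ} (g : Fin m → unitaryGroup (Fin N) ℂ × unitaryGroup (Fin N) ℂ) (k : ℕ) :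
    Matrix (Fin N × Fin N) (Fin N × Fin N) ℂ :=
  if h : k < m then ((g ⟨k, h⟩).1 : Matrix (Fin N) (Fin N) ℂ) ⊗ₖ
    ((g ⟨k, h⟩).2 : Matrix (Fin N) (Fin N) ℂ) else 1

theorem localGates_of_lt {m : ℕ} (g : Fin m → unitaryGroup (Fin N) ℂ × unitaryGroup (Fin N) ℂ)
    {k : ℕ} (h : k < m) : localGates g k = (g ⟨k, h⟩).1.1 ⊗ₖ (g ⟨k, h⟩).2.1 := dif_pos h

theorem chainGate_localGates_snoc (Us : ℕ → Matrix (Fin N × Fin N) (Fin N × Fin N) ℂ) {m : ℕ}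
    (g : Fin m → unitaryGroup (Fin N) ℂ × unitaryGroup (Fin N) ℂ)
    (w : unitaryGroup (Fin N) ℂ × unitaryGroup (Fin N) ℂ) :
    chainGate Us (localGates (Fin.snoc (α := fun _ => _) g w)) (m + 1) =
      Us (m + 1) * (w.1.1 ⊗ₖ w.2.1) * chainGate Us (localGates g) m := by
  rw [chainGate, localGates_of_lt _ m.lt_succ_self]
  congr 1
  · have h : (⟨m, m.lt_succ_self⟩ : Fin (m + 1)) = Fin.last m := rfl
    rw [h, Fin.snoc_last]
  · refine chainGate_congr Us fun k hk => ?_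
    have h : (⟨k, Nat.lt_succ_of_lt hk⟩ : Fin (m + 1)) = Fin.castSucc ⟨k, hk⟩ := rfl
    rw [localGates_of_lt _ (Nat.lt_succ_of_lt hk), localGates_of_lt _ hk, h, Fin.snoc_castSucc]

theorem continuous_chainGate_localGates (Us : ℕ → Matrix (Fin N × Fin N) (Fin N × Fin N) ℂ)
    (m : ℕ) : Continuous fun g : Fin m → unitaryGroup (Fin N) ℂ × unitaryGroup (Fin N) ℂ =>
      chainGate Us (localGates g) m := by
  refine continuous_chainGate Us fun k hk => ?_
  simp only [localGates_of_lt _ hk]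
  exact continuous_local_kronecker.comp (continuous_apply _)

theorem integral_pi_succ {X : Type*} [MeasurableSpace X] (ν : Measure X) [IsProbabilityMeasure ν]
    {m : ℕ} (F : (Fin (m + 1) → X) → ℝ) (hF : Integrable F (Measure.pi fun _ => ν)) :
    ∫ g, F g ∂(Measure.pi fun _ => ν) =
      ∫ g, ∫ w, F (Fin.snoc (α := fun _ => X) g w) ∂ν ∂(Measure.pi fun _ : Fin m => ν) := by
  have h := measurePreserving_piFinSuccAbove (fun _ : Fin (m + 1) => ν) (Fin.last m)
  have e (x : X × (Fin m → X)) : (MeasurableEquiv.piFinSuccAbove (fun _ : Fin (m + 1) => X)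
      (Fin.last m)).symm x = Fin.snoc (α := fun _ => X) x.2 x.1 := by
    simp [MeasurableEquiv.piFinSuccAbove, Fin.insertNthEquiv]
  rw [← h.symm.integral_comp' F]
  have hi := (h.symm.integrable_comp_emb (MeasurableEquiv.measurableEmbedding _)).mpr hF
  refine (integral_prod_symm _ hi).trans ?_
  simp only [Function.comp_apply, e]

theorem integral_chainGate (hN : 2 ≤ N) (μ : Measure (unitaryGroup (Fin N) ℂ))
    [IsProbabilityMeasure μ] [μ.IsMulLeftInvariant]
    (Us : ℕ → Matrix (Fin N × Fin N) (Fin N × Fin N) ℂ) (m : ℕ)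
    (hUs : ∀ k ≤ m, Us k ∈ unitaryGroup (Fin N × Fin N) ℂ) :
    ∫ g : Fin m → unitaryGroup (Fin N) ℂ × unitaryGroup (Fin N) ℂ,
        (1 - ep N (chainGate Us (localGates g) m) / epBar N) ∂(Measure.pi fun _ => μ.prod μ) =
      ∏ k ∈ Finset.range (m + 1), (1 - ep N (Us k) / epBar N) := by
  induction m with
  | zero => simp [chainGate]
  | succ m ih =>
    have hc : Continuous fun g : Fin (m + 1) → unitaryGroup (Fin N) ℂ × unitaryGroup (Fin N) ℂ =>
        1 - ep N (chainGate Us (localGates g) (m + 1)) / epBar N :=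
      continuous_const.sub
        ((continuous_ep.comp (continuous_chainGate_localGates Us (m + 1))).div_const _)
    have hV (g : Fin m → unitaryGroup (Fin N) ℂ × unitaryGroup (Fin N) ℂ) :
        chainGate Us (localGates g) m ∈ unitaryGroup (Fin N × Fin N) ℂ := by
      refine chainGate_mem_unitaryGroup (fun k hk => hUs k (Nat.le_succ_of_le hk)) fun k hk => ?_
      rw [localGates_of_lt g hk]
      exact kronecker_mem_unitary (g ⟨k, hk⟩).1.2 (g ⟨k, hk⟩).2.2
    rw [integral_pi_succ _ _ (integrable_of_continuous hc), Finset.prod_range_succ, mul_comm,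
      ← ih fun k hk => hUs k (Nat.le_succ_of_le hk), ← integral_const_mul]
    simp only [chainGate_localGates_snoc,
      integral_one_sub_ep_div_epBar μ hN (hUs (m + 1) le_rfl) (hV _)]

end Chain

/-- For unitaries `U_1, …, U_n` on `ℂ^N ⊗ ℂ^N` (here `Us k = U_{k+1}`),
the average of the entangling power of `U_n·W_{n-1}·U_{n-1} ⋯ W_1·U_1` over the
interlacing local gates, with all local unitaries drawn independently from the Haar
probability measure on `U(N)`, equals `ē_p (1 - ∏_{k=1}^n (1 - e_p(U_k)/ē_p))`. -/
theorem entangling_power_chain_average (N : ℕ) (hN : 2 ≤ N) (n : ℕ) (hn : 1 ≤ n)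
    (Us : ℕ → Matrix (Fin N × Fin N) (Fin N × Fin N) ℂ)
    (hUs : ∀ k < n, Us k ∈ Matrix.unitaryGroup (Fin N × Fin N) ℂ)
    (μ : Measure (Matrix.unitaryGroup (Fin N) ℂ)) [μ.IsHaarMeasure] [IsProbabilityMeasure μ] :
    (∫ g : Fin (n - 1) → Matrix.unitaryGroup (Fin N) ℂ × Matrix.unitaryGroup (Fin N) ℂ,
        ep N (chainGate Us
          (fun k => if h : k < n - 1 then
              ((g ⟨k, h⟩).1 : Matrix (Fin N) (Fin N) ℂ) ⊗ₖ
                ((g ⟨k, h⟩).2 : Matrix (Fin N) (Fin N) ℂ)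
            else 1) (n - 1))
        ∂(Measure.pi fun _ => μ.prod μ))
      = epBar N * (1 - ∏ k ∈ Finset.range n, (1 - ep N (Us k) / epBar N)) := by
  obtain ⟨m, rfl⟩ : ∃ m, n = m + 1 := ⟨n - 1, by lia⟩
  have h := integral_chainGate hN μ Us m fun k hk => hUs k (Nat.lt_succ_of_le hk)
  have hi : Integrable (fun g : Fin m → unitaryGroup (Fin N) ℂ × unitaryGroup (Fin N) ℂ =>
      ep N (chainGate Us (localGates g) m) / epBar N) (Measure.pi fun _ => μ.prod μ) :=
    integrable_of_continuous
      ((continuous_ep.comp (continuous_chainGate_localGates Us m)).div_const _)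
  have hN' : (2 : ℝ) ≤ N := by exact_mod_cast hN
  have he : epBar N ≠ 0 := div_ne_zero (pow_ne_zero 2 (by linarith)) (by positivity)
  rw [integral_sub (integrable_const 1) hi, integral_const, probReal_univ, one_smul,
    integral_div] at h
  rw [← h, sub_sub_cancel, mul_div_cancel₀ _ he]
  rfl
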